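/- If the coin system C = (1, c_2, c_3, ..., c_n) is orderly, then for every k with 3 ≤ k ≤ n, the three-value coin system (1, c_2, c_k) is orderly. -/

import Mathlib

/-- The largest coin value in `C` that is at most `v` (or 0 if none). -/
def coinMax (C : List ℕ) (v : ℕ) : ℕ := (C.filter (· ≤ v)).foldr max 0

/-- Fuelled greedy coin count. -/
def grdAux (C : List ℕ) : ℕ → ℕ → ℕ
  | 0, _ => 0
  | fuel + 1, v =>
    let c := coinMax C v
    if v = 0 ∨ c = 0 then 0 else 1 + grdAux C fuel (v - c)

/-- Number of coins used by the greedy algorithm to represent `v` with coin system `C`. -/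
def grd (C : List ℕ) (v : ℕ) : ℕ := grdAux C v v

/-- The set of sizes of representations of `v` as nonnegative integer combinations of
the coin values in `C`. -/
def reprCosts (C : List ℕ) (v : ℕ) : Set ℕ :=
  {k | ∃ x : List ℕ, x.length = C.length ∧ (List.zipWith (· * ·) x C).sum = v ∧ x.sum = k}

/-- Minimum number of coins needed to represent `v` with coin system `C`. -/
noncomputable def opt (C : List ℕ) (v : ℕ) : ℕ := sInf (reprCosts C v)

/-- A coin system is orderly if greedy is optimal for every positive value. -/
def Orderly (C : List ℕ) : Prop := ∀ v : ℕ, 0 < v → grd C v = opt C v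

theorem coinMax_le (C : List ℕ) (v : ℕ) : coinMax C v ≤ v := by
  induction C with
  | nil => simp [coinMax]
  | cons c C ih =>
    unfold coinMax at *
    by_cases h : c ≤ v
    · simp [List.filter_cons, h, ih]
    · simpa [List.filter_cons, h] using ih

theorem le_coinMax (C : List ℕ) (v x : ℕ) (hx : x ∈ C) (hv : x ≤ v) : x ≤ coinMax C v := by
  induction C with
  | nil => simp at hx
  | cons c C ih =>
    unfold coinMax at *
    rcases List.mem_cons.1 hx with rfl | hx
    · simp [List.filter_cons, hv]
    · have := ih hx
      by_cases h : c ≤ v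
      · simp [List.filter_cons, h, this]
      · simpa [List.filter_cons, h] using this

theorem coinMax_mem (C : List ℕ) (v : ℕ) : coinMax C v = 0 ∨ coinMax C v ∈ C := by
  induction C with
  | nil => simp [coinMax]
  | cons c C ih =>
    unfold coinMax at *
    by_cases h : c ≤ v
    · simp only [List.filter_cons, h, decide_true, if_true, List.foldr_cons]
      rcases max_choice c ((C.filter (· ≤ v)).foldr max 0) with h1 | h1
      · right; rw [h1]; simp
      · rw [h1]
        rcases ih with h2 | h2
        · left; exact h2
        · right; exact List.mem_cons_of_mem _ h2
    · simp only [List.filter_cons, h, decide_false]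
      rcases ih with h2 | h2
      · left; exact h2
      · right; exact List.mem_cons_of_mem _ h2

theorem grdAux_fuel (C : List ℕ) (v : ℕ) :
    ∀ n m, v ≤ n → v ≤ m → grdAux C n v = grdAux C m v := by
  induction v using Nat.strong_induction_on with
  | _ v ih =>
    intro n m hn hm
    rcases n with _ | n
    · obtain rfl : v = 0 := by omega
      rcases m with _ | m <;> simp [grdAux]
    · rcases m with _ | m
      · obtain rfl : v = 0 := by omega
        simp [grdAux]
      · simp only [grdAux]
        split_ifs with h
        · rfl
        · have := coinMax_le C v
          push Not at h
          rw [ih (v - coinMax C v) (by omega) n m (by omega) (by omega)]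

theorem grd_zero (C : List ℕ) : grd C 0 = 0 := rfl

/-- Greedy recursion along the largest coin. -/
theorem grd_rec (C : List ℕ) (v e : ℕ) (he : e ∈ C) (h0 : 0 < e) (hv : e ≤ v)
    (hmax : ∀ x ∈ C, x ≤ v → x ≤ e) : grd C v = 1 + grd C (v - e) := by
  have h1 : coinMax C v = e := by
    apply le_antisymm
    · rcases coinMax_mem C v with h | h
      · omega
      · exact hmax _ h (coinMax_le C v)
    · exact le_coinMax C v e he hv
  unfold grd
  rcases v with _ | v
  · omega
  · conv_lhs => unfold grdAux
    simp only [h1]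
    rw [if_neg (by omega)]
    rw [grdAux_fuel C (v + 1 - e) v (v + 1 - e) (by omega) le_rfl]

theorem zero_repr (C : List ℕ) : 0 ∈ reprCosts C 0 := by
  induction C with
  | nil => exact ⟨[], by simp⟩
  | cons c C ih =>
    obtain ⟨x, h1, h2, h3⟩ := ih
    exact ⟨0 :: x, by simp [h1], by simp [h2], by simp [h3]⟩

theorem add_repr (C : List ℕ) (y : ℕ) (hy : y ∈ C) :
    ∀ v k, k ∈ reprCosts C v → k + 1 ∈ reprCosts C (v + y) := by
  induction C with
  | nil => simp at hy
  | cons c C ih =>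
    rintro v k ⟨x, h1, h2, h3⟩
    rcases x with _ | ⟨x0, x⟩
    · simp at h1
    simp at h1 h2 h3
    rcases List.mem_cons.1 hy with rfl | hy
    · refine ⟨(x0 + 1) :: x, by simp [h1], ?_, ?_⟩
      · simp; rw [← h2]; ring
      · simp; omega
    · obtain ⟨x', g1, g2, g3⟩ := ih hy _ _ ⟨x, h1, rfl, rfl⟩
      refine ⟨x0 :: x', by simp [g1], ?_, ?_⟩
      · simp [g2]; omega
      · simp [g3]; omega

theorem repr_lower (g : ℕ → ℕ) (C : List ℕ) (hg : ∀ x ∈ C, ∀ v, g (v + x) ≤ g v + 1) :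
    ∀ (x : List ℕ) (v : ℕ), g (v + (List.zipWith (· * ·) x C).sum) ≤ g v + x.sum := by
  induction C with
  | nil => intro x v; simp
  | cons c C ih =>
    intro x v
    rcases x with _ | ⟨x0, x⟩
    · simp
    have key : ∀ n, g (v + n * c) ≤ g v + n := by
      intro n
      induction n with
      | zero => simp
      | succ n ihn =>
        have := hg c (by simp) (v + n * c)
        rw [show v + (n + 1) * c = v + n * c + c by ring]
        omega
    have h1 := ih (fun y hy => hg y (List.mem_cons_of_mem _ hy)) x (v + x0 * c)
    have h2 := key x0
    simp only [List.zipWith_cons_cons, List.sum_cons]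
    rw [← add_assoc]
    omega

theorem exists_max (C : List ℕ) (h1 : 1 ∈ C) (v : ℕ) (hv : 0 < v) :
    ∃ e ∈ C, 0 < e ∧ e ≤ v ∧ ∀ x ∈ C, x ≤ v → x ≤ e := by
  have h := le_coinMax C v 1 h1 hv
  refine ⟨coinMax C v, ?_, h, coinMax_le C v, fun x hx hxv => le_coinMax C v x hx hxv⟩
  rcases coinMax_mem C v with h' | h'
  · omega
  · exact h'

theorem grd_mem (C : List ℕ) (h1 : 1 ∈ C) (v : ℕ) : grd C v ∈ reprCosts C v := by
  induction v using Nat.strong_induction_on with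
  | _ v ih =>
    rcases Nat.eq_zero_or_pos v with rfl | hv
    · exact zero_repr C
    · obtain ⟨e, he, h0, hev, hm⟩ := exists_max C h1 v hv
      rw [grd_rec C v e he h0 hev hm]
      have := add_repr C e he _ _ (ih (v - e) (by omega))
      rw [Nat.sub_add_cancel hev] at this
      rwa [add_comm]

theorem grd_add_le (C : List ℕ) (h1 : 1 ∈ C) (hord : Orderly C) (x : ℕ) (hx : x ∈ C) (v : ℕ) :
    grd C (v + x) ≤ grd C v + 1 := by
  rcases Nat.eq_zero_or_pos (v + x) with h | h
  · rw [h, grd_zero]; omega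
  · rw [hord _ h]
    exact Nat.sInf_le (add_repr C x hx _ _ (grd_mem C h1 v))

theorem orderly_of_add_le (C : List ℕ) (h1 : 1 ∈ C)
    (hg : ∀ x ∈ C, ∀ v, grd C (v + x) ≤ grd C v + 1) : Orderly C := by
  intro v _
  apply le_antisymm
  · obtain ⟨x, _, h2, h3⟩ := Nat.sInf_mem (⟨_, grd_mem C h1 v⟩ : (reprCosts C v).Nonempty)
    have := repr_lower (grd C) C hg x 0
    rw [zero_add, h2, grd_zero, h3, zero_add] at this
    exact this
  · exact Nat.sInf_le (grd_mem C h1 v)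

/-- Among coins, the next coin above `w`. -/
theorem next_coin (C : List ℕ) (w z : ℕ) (hz : z ∈ C) (hwz : w < z) :
    ∃ y ∈ C, w < y ∧ y ≤ z ∧ ∀ x ∈ C, w < x → y ≤ x := by
  classical
  have hex : ∃ y, y ∈ C ∧ w < y := ⟨z, hz, hwz⟩
  refine ⟨Nat.find hex, (Nat.find_spec hex).1, (Nat.find_spec hex).2,
    Nat.find_min' hex ⟨hz, hwz⟩, fun x hx hwx => Nat.find_min' hex ⟨hx, hwx⟩⟩

/-- No coin of an orderly system is bad. -/
theorem no_bad (C : List ℕ) (a : ℕ) (h1 : 1 ∈ C) (ha : a ∈ C)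
    (hC : ∀ x ∈ C, x = 1 ∨ a ≤ x) (hord : Orderly C) :
    ∀ p ∈ C, a < p → ∀ m s, p + s = m * a → s < a → s < m := by
  intro p
  induction p using Nat.strong_induction_on with
  | _ p ih =>
  intro hp hap m s hps hsa
  by_contra hms
  push Not at hms
  have hm2 : 2 ≤ m := by
    by_contra h
    have : m * a ≤ 1 * a := Nat.mul_le_mul_right a (by omega)
    omega
  have ha3 : 3 ≤ a := by omega
  have hrec := grd_rec C
  have hadd := grd_add_le C h1 hord
  have hsmall : ∀ u, u < a → grd C u = u := by
    intro u
    induction u with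
    | zero => intro _; rfl
    | succ u ihu =>
      intro hu
      rw [hrec (u + 1) 1 h1 one_pos (by omega) (fun x hx hxu => by
        rcases hC x hx with h | h <;> omega)]
      rw [Nat.add_sub_cancel, ihu (by omega)]; omega
  have hmul : ∀ k, grd C (k * a) ≤ k := by
    intro k
    induction k with
    | zero => simp [grd_zero]
    | succ k ihk =>
      have := hadd a ha (k * a)
      rw [add_mul, one_mul]; omega
  have hz : ∀ v, grd C v = 0 → v = 0 := by
    intro v hv
    by_contra hne
    obtain ⟨e, he, h0, hev, hm⟩ := exists_max C h1 v (by omega)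
    rw [hrec v e he h0 hev hm] at hv
    omega
  -- if `E` is the largest coin at most `x + y` for coins `x y`, the rest is zero or a coin
  have htwo : ∀ x ∈ C, ∀ y ∈ C, ∀ E ∈ C, 0 < E → E ≤ x + y → (∀ t ∈ C, t ≤ x + y → t ≤ E) →
      x + y - E = 0 ∨ x + y - E ∈ C := by
    intro x hx y hy E hE hE0 hEv hmax
    have e1 := hrec _ E hE hE0 hEv hmax
    have e2 := hadd y hy x
    have e3 := hadd x hx 0
    rw [zero_add, grd_zero] at e3
    rcases Nat.eq_zero_or_pos (x + y - E) with h | h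
    · left; exact h
    · right
      obtain ⟨e, he, h0, hev, hm⟩ := exists_max C h1 _ h
      have e4 := hrec _ e he h0 hev hm
      have := hz (x + y - E - e) (by omega)
      have : x + y - E = e := by omega
      rw [this]; exact he
  -- initial step
  have h_first : ∃ y ∈ C, p < y ∧ y ≤ m * a ∧ ∀ x ∈ C, p < x → y ≤ x := by
    by_cases h : ∃ z ∈ C, p < z ∧ z ≤ m * a
    · obtain ⟨z, hz1, hz2, hz3⟩ := h
      obtain ⟨y, g1, g2, g3, g4⟩ := next_coin C p z hz1 hz2
      exact ⟨y, g1, g2, by omega, g4⟩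
    · push Not at h
      exfalso
      have e1 := hrec (m * a) p hp (by omega) (by omega) (fun x hx hxv => by
        by_contra hc
        have := h x hx (by omega)
        omega)
      rw [show m * a - p = s by omega, hsmall s hsa] at e1
      have := hmul m
      omega
  -- inductive step
  have hstep : ∀ w ∈ C, ∀ w' ∈ C, p ≤ w → w < w' → w' + 2 ≤ w + p → (∀ x ∈ C, w < x → w' ≤ x) →
      ∃ w'' ∈ C, w' < w'' ∧ w'' + 2 ≤ w' + p ∧ ∀ x ∈ C, w' < x → w'' ≤ x := by
    intro w hw w' hw' hpw hww hgap hcons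
    have hA : ∃ z ∈ C, w' < z ∧ z ≤ w + p := by
      by_contra hno
      push Not at hno
      have hmax : ∀ v, v ≤ w + p → ∀ t ∈ C, t ≤ v → t ≤ w' := by
        intro v hv t ht htv
        by_contra hc
        have := hno t ht (by omega)
        omega
      rcases htwo w hw p hp w' hw' (by omega) (by omega) (hmax _ le_rfl) with h | h
      · omega
      · generalize hf : w + p - w' = f at h
        have hf2 : 2 ≤ f := by omega
        have hfa : a ≤ f := by rcases hC f h with h' | h' <;> omega
        have hfp : f < p := by omega
        -- write f = j a - t
        obtain ⟨j, t, hjt, htj, hta, hj1⟩ : ∃ j t, f + t = j * a ∧ t < j ∧ t < a ∧ 1 ≤ j := by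
          rcases Nat.eq_or_lt_of_le hfa with h' | h'
          · exact ⟨1, 0, by omega, by omega, by omega, le_rfl⟩
          · have hd := Nat.div_add_mod (f + a - 1) a
            have hlt := Nat.mod_lt (f + a - 1) (show 0 < a by omega)
            generalize (f + a - 1) / a = j at hd
            generalize hr : (f + a - 1) % a = r at hd hlt
            have hcomm := mul_comm a j
            have := ih f hfp h h' j (a - 1 - r) (by omega) (by omega)
            exact ⟨j, a - 1 - r, by omega, this, by omega, by omega⟩
        have hjm : j ≤ m := by
          by_contra hc
          have : (m + 1) * a ≤ j * a := Nat.mul_le_mul_right a (by omega)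
          rw [add_mul] at this
          omega
        -- value w + (m-j) a
        have hle : (m - j) * a + j * a = m * a := by rw [← add_mul]; congr 1; omega
        have hja : 1 * a ≤ j * a := Nat.mul_le_mul_right a hj1
        have e1 := hrec (w + (m - j) * a) w' hw' (by omega) (by omega) (hmax _ (by omega))
        rw [show w + (m - j) * a - w' = s - t by omega, hsmall (s - t) (by omega)] at e1
        have e2 : grd C (w + (m - j) * a) ≤ grd C ((m - j) * a) + 1 := by
          rw [add_comm]; exact hadd w hw _
        have e3 := hmul (m - j)
        omega
    obtain ⟨z, hz1, hz2, hz3⟩ := hA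
    obtain ⟨y, g1, g2, g3, g4⟩ := next_coin C w' z hz1 hz2
    refine ⟨y, g1, g2, ?_, g4⟩
    by_cases h1w : w' = w + 1
    · by_contra hbig
      have hmax : ∀ t ∈ C, t ≤ w + a → t ≤ w' := by
        intro t ht htv
        by_contra hc
        have := g4 t ht (by omega)
        omega
      rcases htwo w hw a ha w' hw' (by omega) (by omega) hmax with h | h
      · omega
      · rcases hC _ h with h' | h' <;> omega
    · omega
  -- infinitely many coins
  have hinf : ∀ n, ∃ w ∈ C, ∃ w' ∈ C, p ≤ w ∧ n ≤ w ∧ w < w' ∧ w' + 2 ≤ w + p ∧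
      ∀ x ∈ C, w < x → w' ≤ x := by
    intro n
    induction n with
    | zero =>
      obtain ⟨y, g1, g2, g3, g4⟩ := h_first
      exact ⟨p, hp, y, g1, le_rfl, by omega, g2, by omega, g4⟩
    | succ n ihn =>
      obtain ⟨w, hw, w', hw', k1, k2, k3, k4, k5⟩ := ihn
      obtain ⟨y, g1, g2, g3, g4⟩ := hstep w hw w' hw' k1 k3 k4 k5
      exact ⟨w', hw', y, g1, by omega, by omega, g2, g3, g4⟩
  obtain ⟨w, hw, _, _, _, hn, _⟩ := hinf (C.sum + 1)
  have := List.single_le_sum (l := C) (by simp) w hw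
  omega

/-- The three-coin criterion. -/
theorem three_orderly (a c m s : ℕ) (ha : 1 < a) (hac : a < c) (hcs : c + s = m * a)
    (hsa : s < a) (hsm : s < m) : Orderly [1, a, c] := by
  have hrec := grd_rec [1, a, c]
  have hm2 : 2 ≤ m := by
    by_contra h
    have : m * a ≤ 1 * a := Nat.mul_le_mul_right a (by omega)
    omega
  have hsmall : ∀ u, u < a → grd [1, a, c] u = u := by
    intro u
    induction u with
    | zero => intro _; rfl
    | succ u ihu =>
      intro hu
      rw [hrec (u + 1) 1 (by simp) one_pos (by omega) (fun x hx hxu => by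
        simp at hx; omega)]
      rw [Nat.add_sub_cancel, ihu (by omega)]; omega
  have hA : ∀ v, v + a < c → grd [1, a, c] (v + a) = grd [1, a, c] v + 1 := by
    intro v hv
    rw [hrec (v + a) a (by simp) (by omega) (by omega) (fun x hx hxu => by
        simp at hx; omega), Nat.add_sub_cancel, add_comm]
  have hmulA : ∀ k v, v + k * a < c → grd [1, a, c] (v + k * a) = grd [1, a, c] v + k := by
    intro k
    induction k with
    | zero => simp
    | succ k ihk =>
      intro v hv
      rw [add_mul, one_mul, ← add_assoc] at *
      rw [hA _ hv, ihk v (by omega)]; omega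
  have hB : ∀ v, grd [1, a, c] (v + c) = grd [1, a, c] v + 1 := by
    intro v
    rw [hrec (v + c) c (by simp) (by omega) (by omega) (fun x hx hxu => by
        simp at hx; omega), Nat.add_sub_cancel, add_comm]
  have hone : ∀ v, grd [1, a, c] (v + 1) ≤ grd [1, a, c] v + 1 := by
    intro v
    induction v using Nat.strong_induction_on with
    | _ v ih =>
    by_cases h1 : c ≤ v
    · have e1 := hB (v - c)
      have e2 := hB (v - c + 1)
      have e3 := ih (v - c) (by omega)
      rw [show v - c + c = v by omega] at e1
      rw [show v - c + 1 + c = v + 1 by omega] at e2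
      omega
    · by_cases h2 : v + 1 = c
      · have := hB 0
        rw [zero_add, grd_zero] at this
        rw [h2]; omega
      · by_cases h3 : a ≤ v
        · have e1 := hA (v - a) (by omega)
          have e2 := hA (v - a + 1) (by omega)
          have e3 := ih (v - a) (by omega)
          rw [show v - a + a = v by omega] at e1
          rw [show v - a + 1 + a = v + 1 by omega] at e2
          omega
        · by_cases h4 : v + 1 = a
          · have := hA 0 (by omega)
            rw [zero_add, grd_zero] at this
            rw [h4]; omega
          · rw [hsmall v (by omega), hsmall (v + 1) (by omega)]
  have hAll : ∀ v, grd [1, a, c] (v + a) ≤ grd [1, a, c] v + 1 := by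
    intro v
    induction v using Nat.strong_induction_on with
    | _ v ih =>
    by_cases h1 : c ≤ v
    · have e1 := hB (v - c)
      have e2 := hB (v - c + a)
      have e3 := ih (v - c) (by omega)
      rw [show v - c + c = v by omega] at e1
      rw [show v - c + a + c = v + a by omega] at e2
      omega
    · by_cases h2 : v + a < c
      · exact (hA v h2).le
      · obtain ⟨u, hu⟩ : ∃ u, v + a = u + c := ⟨v + a - c, by omega⟩
        rw [hu, hB, hsmall u (by omega)]
        obtain ⟨n, rfl⟩ : ∃ n, m = n + 2 := ⟨m - 2, by omega⟩
        have e0 : (n + 2) * a = n * a + a + a := by ring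
        by_cases h3 : s ≤ u
        · have e1 := hmulA (n + 1) (u - s) (by rw [add_mul]; omega)
          rw [hsmall (u - s) (by omega),
            show u - s + (n + 1) * a = v by rw [add_mul]; omega] at e1
          omega
        · have e1 := hmulA n (a + u - s) (by omega)
          rw [hsmall (a + u - s) (by omega),
            show a + u - s + n * a = v by omega] at e1
          omega
  apply orderly_of_add_le _ (by simp)
  intro x hx v
  simp at hx
  rcases hx with rfl | rfl | rfl
  · exact hone v
  · exact hAll v
  · exact (hB v).le

theorem stmt_8 (C : List ℕ) (hchain : List.Chain' (· < ·) C)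
    (hhead : C.getD 0 0 = 1) (hord : Orderly C) :
    ∀ k : ℕ, 3 ≤ k → k ≤ C.length →
      Orderly [1, C.getD 1 0, C.getD (k - 1) 0] := by
  intro k hk3 hk
  have hpw : List.Pairwise (· < ·) C := List.isChain_iff_pairwise.1 hchain
  have hlt : ∀ i j, i < j → j < C.length → C.getD i 0 < C.getD j 0 := by
    intro i j hij hj
    rw [List.getD_eq_getElem _ _ hj, List.getD_eq_getElem _ _ (by omega)]
    exact List.pairwise_iff_getElem.1 hpw i j (by omega) hj hij
  have hmem : ∀ i, i < C.length → C.getD i 0 ∈ C := by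
    intro i hi
    rw [List.getD_eq_getElem _ _ hi]
    exact List.getElem_mem hi
  have h1 : 1 ∈ C := hhead ▸ hmem 0 (by omega)
  have h01 := hlt 0 1 (by omega) (by omega)
  have h1k := hlt 1 (k - 1) (by omega) (by omega)
  have hC : ∀ x ∈ C, x = 1 ∨ C.getD 1 0 ≤ x := by
    intro x hx
    obtain ⟨i, hi, rfl⟩ := List.mem_iff_getElem.1 hx
    rw [← List.getD_eq_getElem _ 0 hi]
    rcases i with _ | _ | i
    · left; exact hhead
    · right; exact le_rfl
    · right; exact (hlt 1 (i + 2) (by omega) hi).le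
  have hma := hmem 1 (by omega)
  have hmc := hmem (k - 1) (by omega)
  rw [hhead] at h01
  generalize C.getD 1 0 = a at *
  generalize C.getD (k - 1) 0 = c at *
  have hd := Nat.div_add_mod (c + a - 1) a
  have hr := Nat.mod_lt (c + a - 1) (show 0 < a by omega)
  generalize (c + a - 1) / a = m at hd
  generalize (c + a - 1) % a = r at hd hr
  have hcomm := mul_comm a m
  have e : c + (a - 1 - r) = m * a := by omega
  exact three_orderly a c m (a - 1 - r) h01 h1k e (by omega)
    (no_bad C a h1 hma hC hord c hmc h1k m _ e (by omega))
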